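/- Let φ : ℝ×ℝ² → ℂ be a Schwartz function that is even in its first variable, i.e. φ(−t,ξ) = φ(t,ξ) for all (t,ξ), and let g : ℝ×ℝ² → ℂ be a Schwartz function that is odd in its first variable, i.e. g(−t,ξ) = −g(t,ξ), such that 𝓕g(ω,σ) = 2iω·𝓕φ(√(ω² − ‖σ‖²), σ) for all (ω,σ) with |ω| ≥ ‖σ‖. Then for every (x₁₂,x₃) ∈ ℝ²×ℝ one has (R*g)(x₁₂,x₃) = φ(x₃, x₁₂), i.e. (1/(4π)) ∫_{ℝ²} g(√(‖x₁₂−ξ‖² + x₃²), ξ) · (√(‖x₁₂−ξ‖² + x₃²))^{−1} dξ = φ(x₃, x₁₂). -/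

import Mathlib

open MeasureTheory Real Complex
open scoped RealInnerProductSpace

/-- Fourier transform on `ℝ × ℝ²`:
`𝓕f(ω,σ) = (2π)^{−3/2} ∫ f(t,ξ) e^{i(ωt + σ·ξ)} dt dξ`. -/
noncomputable def FT (f : ℝ × EuclideanSpace ℝ (Fin 2) → ℂ)
    (ω : ℝ) (σ : EuclideanSpace ℝ (Fin 2)) : ℂ :=
  (((2 * π : ℝ) ^ (-(3 : ℝ) / 2) : ℝ) : ℂ) *
    ∫ p : ℝ × EuclideanSpace ℝ (Fin 2),
      f p * Complex.exp (Complex.I * ((ω * p.1 + ⟪σ, p.2⟫ : ℝ) : ℂ))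

/-- Backprojection operator:
`(R*g)(x₁₂,x₃) = (1/(4π)) ∫_{ℝ²} g(√(‖x₁₂−ξ‖² + x₃²), ξ)·(√(‖x₁₂−ξ‖² + x₃²))⁻¹ dξ`. -/
noncomputable def Rstar (g : ℝ × EuclideanSpace ℝ (Fin 2) → ℂ)
    (x : EuclideanSpace ℝ (Fin 2) × ℝ) : ℂ :=
  ((1 / (4 * π) : ℝ) : ℂ) * ∫ ξ : EuclideanSpace ℝ (Fin 2),
    g (Real.sqrt (‖x.1 - ξ‖ ^ 2 + x.2 ^ 2), ξ) /
      ((Real.sqrt (‖x.1 - ξ‖ ^ 2 + x.2 ^ 2) : ℝ) : ℂ)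


abbrev E2 := EuclideanSpace ℝ (Fin 2)
abbrev W3 := WithLp 2 (ℝ × E2)

lemma int_decay {E : Type*} [NormedAddCommGroup E] [NormedSpace ℝ E] [FiniteDimensional ℝ E]
    [MeasurableSpace E] [BorelSpace E] (μ : Measure E) [μ.IsAddHaarMeasure] (n : ℕ)
    (h : Module.finrank ℝ E < n) : Integrable (fun x : E => ((1 + ‖x‖) ^ n)⁻¹) μ := by
  have := integrable_one_add_norm (E := E) (μ := μ) (r := n) (by exact_mod_cast h)
  refine this.congr (Filter.Eventually.of_forall fun x => ?_)
  simp only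
  rw [Real.rpow_neg (by positivity), Real.rpow_natCast]

lemma g_bound (g : SchwartzMap (ℝ × E2) ℂ)
    (hgodd : ∀ (t : ℝ) (ξ : E2), g (-t, ξ) = -g (t, ξ)) :
    ∃ C : ℝ, 0 ≤ C ∧ ∀ t ξ, ‖g (t, ξ)‖ ≤ C * |t| * ((1 + |t|) ^ 5)⁻¹ * ((1 + ‖ξ‖) ^ 3)⁻¹ := by
  obtain ⟨C, hC0, hC⟩ : ∃ C : ℝ, 0 ≤ C ∧ ∀ n ≤ 1, ∀ x : ℝ × E2,
      (1 + ‖x‖) ^ 8 * ‖iteratedFDeriv ℝ n (⇑g) x‖ ≤ C := by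
    refine ⟨2 ^ 8 * ((Finset.Iic ((8, 1) : ℕ × ℕ)).sup
      fun m => SchwartzMap.seminorm ℝ m.1 m.2) g, by positivity, fun n hn x => ?_⟩
    exact SchwartzMap.one_add_le_sup_seminorm_apply (m := (8, 1)) le_rfl hn g x
  have key : ∀ (t : ℝ) (ξ : E2), (1 + |t|) ^ 5 * (1 + ‖ξ‖) ^ 3 ≤ (1 + ‖(t, ξ)‖) ^ 8 := by
    intro t ξ
    have h1 : |t| ≤ ‖(t, ξ)‖ := by simpa using norm_fst_le (t, ξ)
    have h2 : ‖ξ‖ ≤ ‖(t, ξ)‖ := norm_snd_le (t, ξ)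
    calc (1 + |t|) ^ 5 * (1 + ‖ξ‖) ^ 3 ≤ (1 + ‖(t, ξ)‖) ^ 5 * (1 + ‖(t, ξ)‖) ^ 3 := by gcongr
      _ = _ := by ring
  have hz : ∀ ξ, g (0, ξ) = 0 := by
    intro ξ
    have := hgodd 0 ξ
    rw [neg_zero] at this
    exact self_eq_neg.mp this
  refine ⟨32 * C, by positivity, fun t ξ => ?_⟩
  rw [mul_assoc, ← mul_inv, ← div_eq_mul_inv, le_div_iff₀ (by positivity)]
  rcases le_or_gt 1 |t| with ht | ht
  · have := hC 0 (by norm_num) (t, ξ)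
    rw [norm_iteratedFDeriv_zero] at this
    calc ‖g (t, ξ)‖ * ((1 + |t|) ^ 5 * (1 + ‖ξ‖) ^ 3) ≤ ‖g (t, ξ)‖ * (1 + ‖(t, ξ)‖) ^ 8 := by
          gcongr; exact key t ξ
      _ ≤ C := by linarith
      _ ≤ 32 * C * |t| := by nlinarith
  · have hd : ∀ s : ℝ, HasDerivAt (fun s => g (s, ξ)) (fderiv ℝ g (s, ξ) (1, 0)) s := by
      intro s
      have h1 : HasFDerivAt g (fderiv ℝ g (s, ξ)) (s, ξ) := g.differentiableAt.hasFDerivAt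
      have h2 : HasDerivAt (fun s : ℝ => (s, ξ)) ((1 : ℝ), (0 : E2)) s :=
        (hasDerivAt_id s).prodMk (hasDerivAt_const s ξ)
      exact h1.comp_hasDerivAt s h2
    have hb : ∀ s : ℝ, ‖fderiv ℝ g (s, ξ) (1, 0)‖ ≤ C / (1 + ‖ξ‖) ^ 3 := by
      intro s
      have h1 := hC 1 le_rfl (s, ξ)
      rw [norm_iteratedFDeriv_one] at h1
      have h2 : ‖fderiv ℝ g (s, ξ) (1, 0)‖ ≤ ‖fderiv ℝ g (s, ξ)‖ := by
        refine (ContinuousLinearMap.le_opNorm _ _).trans ?_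
        simp [Prod.norm_def]
      rw [le_div_iff₀ (by positivity)]
      have h3 : (1 + ‖ξ‖) ^ 3 ≤ (1 + ‖(s, ξ)‖) ^ 8 := by
        refine le_trans ?_ (key s ξ)
        have : (1:ℝ) ≤ (1 + |s|) ^ 5 := one_le_pow₀ (by linarith [abs_nonneg s])
        nlinarith [show 0 ≤ (1 + ‖ξ‖) ^ 3 by positivity]
      calc _ ≤ ‖fderiv ℝ g (s, ξ)‖ * (1 + ‖(s, ξ)‖) ^ 8 := by gcongr
        _ ≤ C := by linarith
    have hm := Convex.norm_image_sub_le_of_norm_hasDerivWithin_le (s := Set.univ)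
      (f := fun s => g (s, ξ)) (fun x _ => (hd x).hasDerivWithinAt) (fun x _ => hb x) convex_univ
      (Set.mem_univ 0) (Set.mem_univ t)
    simp only [hz, sub_zero, Real.norm_eq_abs] at hm
    calc ‖g (t, ξ)‖ * ((1 + |t|) ^ 5 * (1 + ‖ξ‖) ^ 3)
        ≤ (C / (1 + ‖ξ‖) ^ 3 * |t|) * ((1 + 1) ^ 5 * (1 + ‖ξ‖) ^ 3) := by gcongr
      _ = 32 * C * |t| := by field_simp; norm_num

lemma radial2 (G : ℝ → ℂ) (s : ℝ) :
    ∫ y : E2, G (√(s ^ 2 + ‖y‖ ^ 2)) / (√(s ^ 2 + ‖y‖ ^ 2) : ℝ) =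
      2 * π * ∫ r in Set.Ioi |s|, G r := by
  have h := integral_fun_norm_addHaar (E := E2) volume
    (fun ρ => G (√(s ^ 2 + ρ ^ 2)) / (√(s ^ 2 + ρ ^ 2) : ℝ))
  rw [h]
  have hv : (volume : Measure E2).real (Metric.ball 0 1) = π := by
    rw [Measure.real, InnerProductSpace.volume_ball]
    have h2 : Real.Gamma (1 + 1) = 1 := by rw [one_add_one_eq_two]; exact Real.Gamma_two
    simp [Real.sq_sqrt Real.pi_pos.le, Real.pi_pos.le, h2]
  have himg : (fun ρ : ℝ => √(s ^ 2 + ρ ^ 2)) '' Set.Ioi 0 = Set.Ioi |s| := by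
    ext r
    simp only [Set.mem_image, Set.mem_Ioi]
    constructor
    · rintro ⟨ρ, hρ, rfl⟩
      apply Real.lt_sqrt_of_sq_lt
      rw [sq_abs]; nlinarith
    · intro hr
      have h0 : 0 ≤ |s| := abs_nonneg s
      have h1 : s ^ 2 < r ^ 2 := by rw [← sq_abs s]; nlinarith
      refine ⟨√(r ^ 2 - s ^ 2), Real.sqrt_pos.mpr (by linarith), ?_⟩
      rw [Real.sq_sqrt (by linarith)]
      rw [show s ^ 2 + (r ^ 2 - s ^ 2) = r ^ 2 by ring, Real.sqrt_sq (by linarith)]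
  have hs := integral_image_eq_integral_abs_deriv_smul (s := Set.Ioi (0:ℝ))
    (f := fun ρ : ℝ => √(s ^ 2 + ρ ^ 2)) (f' := fun ρ => ρ / √(s ^ 2 + ρ ^ 2))
    measurableSet_Ioi (by
      intro x hx
      have hx : 0 < x := hx
      have h1 : HasDerivAt (fun ρ : ℝ => s ^ 2 + ρ ^ 2) (2 * x) x := by
        simpa using (hasDerivAt_pow 2 x).const_add (s ^ 2)
      have h2 := h1.sqrt (by positivity)
      refine (h2.congr_deriv ?_).hasDerivWithinAt
      field_simp) (by
      intro a ha b hb hab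
      have ha : 0 < a := ha
      have hb : 0 < b := hb
      simp only at hab
      have := (Real.sqrt_inj (by positivity) (by positivity)).mp hab
      nlinarith) G
  rw [himg] at hs
  rw [hs, hv]
  simp only [finrank_euclideanSpace, Fintype.card_fin, nsmul_eq_mul, Nat.cast_ofNat, real_smul]
  rw [mul_assoc]
  congr 2
  apply setIntegral_congr_fun measurableSet_Ioi
  intro x hx
  have hx : 0 < x := hx
  simp only
  rw [abs_of_nonneg (by positivity)]
  push_cast
  ring

lemma odd_tail (G : ℝ → ℂ) (hi : Integrable G) (hodd : ∀ r, G (-r) = - G r) (s : ℝ) :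
    ∫ r in Set.Ioi |s|, G r = - ∫ r in Set.Iic s, G r := by
  rcases le_total 0 s with h | h
  · rw [abs_of_nonneg h]
    have h1 := intervalIntegral.integral_Iic_add_Ioi (b := s) hi.integrableOn hi.integrableOn
    have h2 : ∫ r, G r = 0 := by
      have := integral_neg_eq_self G volume
      simp only [hodd, integral_neg] at this
      exact neg_eq_self.mp this
    rw [h2] at h1
    exact eq_neg_of_add_eq_zero_right h1
  · rw [abs_of_nonpos h, ← integral_comp_neg_Iic]
    simp [hodd, integral_neg]

lemma parts (G : ℝ → ℂ) (hc : Continuous G) (hi : Integrable G) (l : ℝ) (hl : l ≠ 0)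
    (hP : Integrable (fun s => ∫ r in Set.Iic s, G r)) :
    ∫ s : ℝ, Complex.exp (I * ((l * s : ℝ) : ℂ)) * (∫ r in Set.Iic s, G r) =
      - (1 / (I * l)) * ∫ s : ℝ, Complex.exp (I * ((l * s : ℝ) : ℂ)) * G s := by
  have hlc : (I * l : ℂ) ≠ 0 := by simp [hl]
  have hv : ∀ s : ℝ, HasDerivAt (fun s => ∫ r in Set.Iic s, G r) (G s) s := by
    intro s
    have h1 := (intervalIntegral.integral_hasDerivAt_right (a := 0) (b := s) (f := G)
      (hc.intervalIntegrable _ _) hc.stronglyMeasurable.stronglyMeasurableAtFilter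
      hc.continuousAt)
    have h2 := h1.const_add (∫ r in Set.Iic (0:ℝ), G r)
    refine h2.congr_of_eventuallyEq (Filter.Eventually.of_forall fun x => ?_)
    simp only
    rw [← intervalIntegral.integral_Iic_sub_Iic hi.integrableOn hi.integrableOn]
    ring
  have hu : ∀ s : ℝ, HasDerivAt (fun s : ℝ => (1 / (I * l)) * Complex.exp (I * ((l * s : ℝ) : ℂ)))
      (Complex.exp (I * ((l * s : ℝ) : ℂ))) s := by
    intro s
    have h1 : HasDerivAt (fun s : ℝ => (I * ((l * s : ℝ) : ℂ))) (I * l) s := by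
      have := ((hasDerivAt_id s).const_mul l).ofReal_comp.const_mul I
      simpa using this
    have h2 := h1.cexp.const_mul (1 / (I * l))
    refine h2.congr_deriv ?_
    rw [one_div, mul_comm (Complex.exp _), inv_mul_cancel_left₀ hlc]
  have hn : ∀ s : ℝ, ‖Complex.exp (I * ((l * s : ℝ) : ℂ))‖ = 1 := by
    intro s; rw [mul_comm]; exact Complex.norm_exp_ofReal_mul_I _
  have hcu : Continuous fun s : ℝ => Complex.exp (I * ((l * s : ℝ) : ℂ)) := by fun_prop
  have hint : ∀ F : ℝ → ℂ, Integrable F →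
      Integrable (fun s : ℝ => Complex.exp (I * ((l * s : ℝ) : ℂ)) * F s) := by
    intro F hF
    refine hF.bdd_mul (c := 1) hcu.aestronglyMeasurable
      (Filter.Eventually.of_forall fun s => (hn s).le)
  have := integral_mul_deriv_eq_deriv_mul_of_integrable (fun x _ => hu x) (fun x _ => hv x)
    (by simpa [mul_assoc, Pi.mul_def] using (hint G hi).const_mul (1 / (I * (l:ℂ))))
    (by simpa [mul_assoc, Pi.mul_def] using hint _ hP)
    (by simpa [mul_assoc, Pi.mul_def] using (hint _ hP).const_mul (1 / (I * (l:ℂ))))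
  simp only [mul_assoc, integral_const_mul] at this ⊢
  rw [← neg_eq_iff_eq_neg.mpr this]
  ring

lemma norm_W (w : W3) : ‖w‖ = √(w.fst ^ 2 + ‖w.snd‖ ^ 2) := by
  rw [WithLp.prod_norm_eq_of_L2]; simp

lemma int_W (F : W3 → ℂ) : ∫ w, F w = ∫ p : ℝ × E2, F (WithLp.toLp 2 p) := 
  ((WithLp.volume_preserving_toLp ℝ E2).integral_comp
    (MeasurableEquiv.toLp 2 (ℝ × E2)).measurableEmbedding F).symm

lemma fourier3 (G : ℝ → ℂ) (hc : Continuous G) (hodd : ∀ r, G (-r) = - G r) (C : ℝ) 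
    (hb : ∀ t, ‖G t‖ ≤ C * |t| * ((1 + |t|) ^ 5)⁻¹) (k : W3) (hk : k ≠ 0) :
    ∫ w : W3, Complex.exp (I * (⟪k, w⟫ : ℝ)) * (G ‖w‖ / (‖w‖ : ℝ)) =
      2 * π / (I * ‖k‖) * ∫ r : ℝ, Complex.exp (I * ((‖k‖ * r : ℝ) : ℂ)) * G r := by
  have hk0 : ‖k‖ ≠ 0 := norm_ne_zero_iff.mpr hk
  have hC : 0 ≤ C := by
    have := (norm_nonneg _).trans (hb 1)
    rw [abs_one] at this
    norm_num at this
    linarith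
  have hi : Integrable G := by
    refine ((int_decay (volume : Measure ℝ) 2 (by simp)).const_mul C).mono'
      hc.aestronglyMeasurable (Filter.Eventually.of_forall fun t => (hb t).trans ?_)
    rw [mul_assoc]
    refine mul_le_mul_of_nonneg_left ?_ hC
    rw [Real.norm_eq_abs, ← div_eq_mul_inv, div_le_iff₀ (by positivity), inv_mul_eq_div,
      le_div_iff₀ (by positivity)]
    have h0 := abs_nonneg t
    calc |t| * (1 + |t|) ^ 2 ≤ (1 + |t|) * (1 + |t|) ^ 2 := by gcongr; linarith
      _ = (1 + |t|) ^ 3 := by ring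
      _ ≤ (1 + |t|) ^ 5 := by gcongr <;> linarith
  -- measurability
  have hmH : Measurable fun w : W3 => G ‖w‖ / (‖w‖ : ℝ) := by
    have := hc.measurable
    fun_prop
  have hiH : Integrable fun w : W3 => G ‖w‖ / (‖w‖ : ℝ) := by
    refine ((int_decay (volume : Measure W3) 5 (by
      rw [(WithLp.linearEquiv 2 ℝ (ℝ × E2)).finrank_eq]; simp)).const_mul C).mono'
      hmH.aestronglyMeasurable (Filter.Eventually.of_forall fun w => ?_)
    rw [norm_div, Complex.norm_real, norm_norm]
    rcases eq_or_ne ‖w‖ 0 with h | h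
    · simp [h, hC]
    · have := hb ‖w‖
      rw [abs_norm] at this
      rw [div_le_iff₀ (by positivity)]
      linarith
  -- rotate
  let e : W3 := WithLp.toLp 2 (‖k‖, 0)
  have he : ‖k‖ = ‖e‖ := by rw [norm_W e]; simp [e]
  let R := (ℝ ∙ (k - e))ᗮ.reflection
  have hR : R k = e := Submodule.reflection_sub he
  have h1 : ∫ w : W3, Complex.exp (I * (⟪k, w⟫ : ℝ)) * (G ‖w‖ / (‖w‖ : ℝ)) =
      ∫ w : W3, Complex.exp (I * (⟪e, w⟫ : ℝ)) * (G ‖w‖ / (‖w‖ : ℝ)) := by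
    rw [← R.measurePreserving.integral_comp R.toHomeomorph.measurableEmbedding
      (fun w : W3 => Complex.exp (I * (⟪e, w⟫ : ℝ)) * (G ‖w‖ / (‖w‖ : ℝ)))]
    congr 1
    ext w
    rw [← hR, R.inner_map_map, R.norm_map]
  have hiP : Integrable (fun p : ℝ × E2 => G (√(p.1 ^ 2 + ‖p.2‖ ^ 2)) / (√(p.1 ^ 2 + ‖p.2‖ ^ 2) : ℝ)) := by
    have := (WithLp.volume_preserving_toLp ℝ E2).integrable_comp_of_integrable hiH
    refine this.congr (Filter.Eventually.of_forall fun p => ?_)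
    simp [norm_W]
  have hn : ∀ s : ℝ, ‖Complex.exp (I * (s : ℂ))‖ = 1 := by
    intro s; rw [mul_comm]; exact Complex.norm_exp_ofReal_mul_I _
  have hiP2 : Integrable (fun p : ℝ × E2 => Complex.exp (I * ((‖k‖ * p.1 : ℝ) : ℂ)) *
      (G (√(p.1 ^ 2 + ‖p.2‖ ^ 2)) / (√(p.1 ^ 2 + ‖p.2‖ ^ 2) : ℝ))) := by
    refine hiP.bdd_mul (c := 1) (Continuous.aestronglyMeasurable (by fun_prop))
      (Filter.Eventually.of_forall fun s => (hn _).le)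
  rw [h1, int_W]
  have h2 : ∫ p : ℝ × E2, Complex.exp (I * (⟪e, WithLp.toLp 2 p⟫ : ℝ)) *
        (G ‖(WithLp.toLp 2 p : W3)‖ / (‖(WithLp.toLp 2 p : W3)‖ : ℝ)) =
      ∫ p : ℝ × E2, Complex.exp (I * ((‖k‖ * p.1 : ℝ) : ℂ)) *
      (G (√(p.1 ^ 2 + ‖p.2‖ ^ 2)) / (√(p.1 ^ 2 + ‖p.2‖ ^ 2) : ℝ)) := by
    congr 1
    ext p
    rw [norm_W, WithLp.prod_inner_apply]
    simp [e, mul_comm]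
  rw [h2, Measure.volume_eq_prod, integral_prod _ hiP2]
  have hPi : Integrable (fun s => ∫ r in Set.Iic s, G r) := by
    have := (hiP.integral_prod_left).const_mul (- (1 / (2 * π)) : ℂ)
    refine this.congr (Filter.Eventually.of_forall fun s => ?_)
    simp only
    rw [radial2 G s, odd_tail G hi hodd]
    have : (π : ℂ) ≠ 0 := by exact_mod_cast Real.pi_ne_zero
    field_simp
    try ring
  have h3 := parts G hc hi ‖k‖ hk0 hPi
  simp only [integral_const_mul, radial2 G, odd_tail G hi hodd]
  have h4 : ∫ s : ℝ, Complex.exp (I * ((‖k‖ * s : ℝ) : ℂ)) * (2 * π * -∫ r in Set.Iic s, G r)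
    = (-(2 * π)) * ∫ s : ℝ, Complex.exp (I * ((‖k‖ * s : ℝ) : ℂ)) * (∫ r in Set.Iic s, G r) := by
    rw [← integral_const_mul]
    congr 1; ext s; ring
  rw [h4, h3]
  ring

lemma cexp_norm (s : ℝ) : ‖Complex.exp (I * (s : ℂ))‖ = 1 := by
  rw [mul_comm]; exact Complex.norm_exp_ofReal_mul_I _

/-- the embedding of the plane -/
noncomputable def tau (ξ : E2) : W3 := WithLp.toLp 2 (0, ξ)

lemma norm_sub_tau (w : W3) (ξ : E2) : ‖w - tau ξ‖ = √(‖w.snd - ξ‖ ^ 2 + w.fst ^ 2) := by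
  rw [norm_W, add_comm]; simp [tau]

lemma tau_cont : Continuous tau := by
  unfold tau; fun_prop

section main
variable (g : SchwartzMap (ℝ × E2) ℂ) (C : ℝ)

noncomputable def FF (g : SchwartzMap (ℝ × E2) ℂ) (p : W3 × E2) : ℂ := g (‖p.1‖, p.2) / (‖p.1‖ : ℝ)

lemma FF_meas : Measurable (FF g) := by
  have := g.continuous.measurable
  unfold FF
  fun_prop

lemma FF_bound (hC : 0 ≤ C)
    (hb : ∀ t ξ, ‖g (t, ξ)‖ ≤ C * |t| * ((1 + |t|) ^ 5)⁻¹ * ((1 + ‖ξ‖) ^ 3)⁻¹) (p : W3 × E2) :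
    ‖FF g p‖ ≤ C * (((1 + ‖p.1‖) ^ 5)⁻¹ * ((1 + ‖p.2‖) ^ 3)⁻¹) := by
  unfold FF
  rw [norm_div, Complex.norm_real, norm_norm]
  rcases eq_or_ne ‖p.1‖ 0 with h | h
  · rw [h]; simp; positivity
  · have := hb ‖p.1‖ p.2
    rw [abs_norm] at this
    rw [div_le_iff₀ (by positivity)]
    linarith

lemma finrank_W3 : Module.finrank ℝ W3 = 3 := by
  rw [(WithLp.linearEquiv 2 ℝ (ℝ × E2)).finrank_eq]; simp

lemma FF_int (hC : 0 ≤ C)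
    (hb : ∀ t ξ, ‖g (t, ξ)‖ ≤ C * |t| * ((1 + |t|) ^ 5)⁻¹ * ((1 + ‖ξ‖) ^ 3)⁻¹) :
    Integrable (FF g) ((volume : Measure W3).prod (volume : Measure E2)) := by
  refine (((int_decay (volume : Measure W3) 5 (by rw [finrank_W3]; norm_num)).mul_prod
    (int_decay (volume : Measure E2) 3 (by simp))).const_mul C).mono'
    (FF_meas g).aestronglyMeasurable (Filter.Eventually.of_forall fun p => FF_bound g C hC hb p)

lemma FFs_int (hC : 0 ≤ C)
    (hb : ∀ t ξ, ‖g (t, ξ)‖ ≤ C * |t| * ((1 + |t|) ^ 5)⁻¹ * ((1 + ‖ξ‖) ^ 3)⁻¹) :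
    Integrable (fun p : W3 × E2 => FF g (p.1 - tau p.2, p.2))
      ((volume : Measure W3).prod (volume : Measure E2)) := by
  have hm : Measurable (fun p : W3 × E2 => FF g (p.1 - tau p.2, p.2)) := by
    have h1 := FF_meas g
    have h2 := tau_cont.measurable
    fun_prop
  have h0 := (integrable_prod_iff' (FF_meas g).aestronglyMeasurable).mp (FF_int g C hC hb)
  refine (integrable_prod_iff' hm.aestronglyMeasurable).mpr ⟨?_, ?_⟩
  · filter_upwards [h0.1] with ξ hξ
    exact hξ.comp_sub_right (tau ξ)
  · refine h0.2.congr (Filter.Eventually.of_forall fun ξ => ?_)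
    exact (integral_sub_right_eq_self (fun w => ‖FF g (w, ξ)‖) (tau ξ)).symm

lemma Rstar_eq (w : W3) :
    Rstar g (w.snd, w.fst) = ((1 / (4 * π) : ℝ) : ℂ) * ∫ ξ, FF g (w - tau ξ, ξ) := by
  unfold Rstar FF
  simp only [norm_sub_tau]

lemma Rstar_int (hC : 0 ≤ C)
    (hb : ∀ t ξ, ‖g (t, ξ)‖ ≤ C * |t| * ((1 + |t|) ^ 5)⁻¹ * ((1 + ‖ξ‖) ^ 3)⁻¹) :
    Integrable (fun w : W3 => Rstar g (w.snd, w.fst)) := by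
  simp only [Rstar_eq]
  exact (FFs_int g C hC hb).integral_prod_left.const_mul _

lemma Rstar_cont (hC : 0 ≤ C)
    (hb : ∀ t ξ, ‖g (t, ξ)‖ ≤ C * |t| * ((1 + |t|) ^ 5)⁻¹ * ((1 + ‖ξ‖) ^ 3)⁻¹) :
    Continuous (fun w : W3 => Rstar g (w.snd, w.fst)) := by
  simp only [Rstar_eq]
  refine continuous_const.mul ?_
  have h1 : ∀ w : W3, ∫ ξ, FF g (w - tau ξ, ξ) =
      ∫ y : E2, FF g (WithLp.toLp 2 (w.fst, y), w.snd - y) := by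
    intro w
    rw [← integral_sub_left_eq_self (fun ξ => FF g (w - tau ξ, ξ)) volume w.snd]
    congr 1
    ext y
    congr 2
    apply (WithLp.linearEquiv 2 ℝ (ℝ × E2)).injective
    ext <;> simp [tau]
  simp only [h1]
  refine continuous_of_dominated (bound := fun y => C * ((1 + ‖y‖) ^ 3)⁻¹) ?_ ?_ ?_ ?_
  · intro w
    have := FF_meas g
    exact Measurable.aestronglyMeasurable (by fun_prop)
  · intro w
    refine Filter.Eventually.of_forall fun y => (FF_bound g C hC hb _).trans ?_
    refine mul_le_mul_of_nonneg_left ?_ hC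
    have h3 : ‖y‖ ≤ ‖(WithLp.toLp 2 (w.fst, y) : W3)‖ := by
      rw [norm_W]
      apply Real.le_sqrt_of_sq_le
      simp; positivity
    have h4 : ((1 + ‖w.snd - y‖) ^ 3)⁻¹ ≤ 1 :=
      inv_le_one_of_one_le₀ (one_le_pow₀ (by linarith [norm_nonneg (w.snd - y)]))
    calc _ ≤ ((1 + ‖(WithLp.toLp 2 (w.fst, y) : W3)‖) ^ 5)⁻¹ * 1 := by
          simp only; gcongr
      _ ≤ ((1 + ‖y‖) ^ 3)⁻¹ := by
        rw [mul_one]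
        apply inv_anti₀ (by positivity)
        calc (1 + ‖y‖) ^ 3 ≤ (1 + ‖y‖) ^ 5 := by
              gcongr
              · linarith [norm_nonneg y]
              · norm_num
          _ ≤ _ := by gcongr
  · exact (int_decay _ 3 (by simp)).const_mul C
  · have : ∀ᵐ y : E2, y ≠ 0 := by
      rw [ae_iff]; simp
    filter_upwards [this] with y hy
    unfold FF
    have hg := g.continuous
    refine Continuous.div (by fun_prop) (by fun_prop) fun w => ?_
    simp only [ne_eq, Complex.ofReal_eq_zero, norm_eq_zero]
    intro h
    apply hy
    have := congrArg WithLp.snd h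
    simpa using this

lemma main_fourier (φ : SchwartzMap (ℝ × E2) ℂ) (hC : 0 ≤ C)
    (hb : ∀ t ξ, ‖g (t, ξ)‖ ≤ C * |t| * ((1 + |t|) ^ 5)⁻¹ * ((1 + ‖ξ‖) ^ 3)⁻¹)
    (hφeven : ∀ (t : ℝ) (ξ : EuclideanSpace ℝ (Fin 2)), φ (-t, ξ) = φ (t, ξ))
    (hgodd : ∀ (t : ℝ) (ξ : EuclideanSpace ℝ (Fin 2)), g (-t, ξ) = -g (t, ξ))
    (hFT : ∀ (ω : ℝ) (σ : EuclideanSpace ℝ (Fin 2)), ‖σ‖ ≤ |ω| →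
      FT (⇑g) ω σ = 2 * Complex.I * (ω : ℂ) * FT (⇑φ) (Real.sqrt (ω ^ 2 - ‖σ‖ ^ 2)) σ)
    (k : W3) (hk : k ≠ 0) :
    ∫ w : W3, Complex.exp (I * (⟪k, w⟫ : ℝ)) * Rstar g (w.snd, w.fst) =
      ∫ w : W3, Complex.exp (I * (⟪k, w⟫ : ℝ)) * φ (w.fst, w.snd) := by
  have hk0 : ‖k‖ ≠ 0 := norm_ne_zero_iff.mpr hk
  have hkc : (‖k‖ : ℂ) ≠ 0 := by exact_mod_cast hk0
  have hpi : (π : ℂ) ≠ 0 := by exact_mod_cast Real.pi_ne_zero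
  have hc0 : (((2 * π : ℝ) ^ (-(3 : ℝ) / 2) : ℝ) : ℂ) ≠ 0 := by
    have : 0 < (2 * π : ℝ) ^ (-(3 : ℝ) / 2) := Real.rpow_pos_of_pos (by positivity) _
    exact_mod_cast this.ne'
  -- the right-hand side
  have hR : (((2 * π : ℝ) ^ (-(3 : ℝ) / 2) : ℝ) : ℂ) *
      ∫ w : W3, Complex.exp (I * (⟪k, w⟫ : ℝ)) * φ (w.fst, w.snd) = FT φ k.fst k.snd := by
    unfold FT
    rw [int_W]
    congr 2
    ext p
    rw [WithLp.prod_inner_apply, mul_comm]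
    simp [mul_comm]
  have heven : FT φ (√(‖k‖ ^ 2 - ‖k.snd‖ ^ 2)) k.snd = FT φ k.fst k.snd := by
    rw [WithLp.prod_norm_sq_eq_of_L2, add_sub_cancel_right, Real.sqrt_sq (norm_nonneg _),
      Real.norm_eq_abs]
    rcases abs_choice k.fst with h | h
    · rw [h]
    · rw [h]
      unfold FT
      congr 1
      have hmp : MeasurePreserving (Prod.map (fun t : ℝ => -t) (id : E2 → E2))
          (volume.prod volume) (volume.prod volume) :=
        (Measure.measurePreserving_neg volume).prod (MeasurePreserving.id volume)
      have he : MeasurableEmbedding (Prod.map (fun t : ℝ => -t) (id : E2 → E2)) :=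
        ((MeasurableEquiv.neg ℝ).prodCongr (MeasurableEquiv.refl E2)).measurableEmbedding
      rw [Measure.volume_eq_prod, ← hmp.integral_comp he]
      congr 1
      ext p
      simp
      exact hφeven p.1 p.2
  have hle : ‖k.snd‖ ≤ |‖k‖| := by
    rw [abs_norm, norm_W]
    exact Real.le_sqrt_of_sq_le (by nlinarith [sq_nonneg k.fst])
  have hg := hFT ‖k‖ k.snd hle
  rw [heven, ← hR] at hg
  -- the left-hand side
  have hF := FFs_int g C hC hb
  have hcont : Continuous fun p : W3 × E2 => Complex.exp (I * (⟪k, p.1⟫ : ℝ)) := by fun_prop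
  have hF2 : Integrable (fun p : W3 × E2 => Complex.exp (I * (⟪k, p.1⟫ : ℝ)) *
      FF g (p.1 - tau p.2, p.2)) ((volume : Measure W3).prod (volume : Measure E2)) :=
    hF.bdd_mul (c := 1) hcont.aestronglyMeasurable
      (Filter.Eventually.of_forall fun s => (cexp_norm _).le)
  have hinner : ∀ ξ : E2, ∫ w : W3, Complex.exp (I * (⟪k, w⟫ : ℝ)) * FF g (w - tau ξ, ξ) =
      2 * π / (I * ‖k‖) * ∫ r : ℝ, g (r, ξ) *
        Complex.exp (Complex.I * ((‖k‖ * r + ⟪k.snd, ξ⟫ : ℝ) : ℂ)) := by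
    intro ξ
    rw [← integral_add_right_eq_self _ (tau ξ)]
    have h1 : ∀ w : W3, Complex.exp (I * (⟪k, w + tau ξ⟫ : ℝ)) * FF g (w + tau ξ - tau ξ, ξ) =
        Complex.exp (I * (⟪k.snd, ξ⟫ : ℝ)) *
        (Complex.exp (I * (⟪k, w⟫ : ℝ)) * (g (‖w‖, ξ) / (‖w‖ : ℝ))) := by
      intro w
      have : ⟪k, tau ξ⟫ = ⟪k.snd, ξ⟫ := by
        rw [WithLp.prod_inner_apply]; simp [tau]
      rw [add_sub_cancel_right, inner_add_right, this, Complex.ofReal_add, mul_add, Complex.exp_add]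
      unfold FF
      ring
    simp only [h1, integral_const_mul]
    have hgc := g.continuous
    rw [fourier3 (fun r => g (r, ξ)) (by fun_prop) (fun r => hgodd r ξ) C (fun t => ?_) k hk]
    · rw [mul_left_comm, ← integral_const_mul]
      congr 2
      ext r
      rw [Complex.ofReal_add, mul_add, Complex.exp_add]
      ring
    · refine (hb t ξ).trans (mul_le_of_le_one_right (by positivity) ?_)
      exact inv_le_one_of_one_le₀ (one_le_pow₀ (by linarith [norm_nonneg ξ]))
  have hgi : Integrable (fun p : ℝ × E2 => g p *
        Complex.exp (Complex.I * ((‖k‖ * p.1 + ⟪k.snd, p.2⟫ : ℝ) : ℂ)))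
        ((volume : Measure ℝ).prod (volume : Measure E2)) := by
    have h1 : Integrable g ((volume : Measure ℝ).prod (volume : Measure E2)) := g.integrable
    exact h1.mul_bdd (c := 1) (Continuous.aestronglyMeasurable (by fun_prop))
      (Filter.Eventually.of_forall fun s => (cexp_norm _).le)
  have hL : ∫ w : W3, Complex.exp (I * (⟪k, w⟫ : ℝ)) * Rstar g (w.snd, w.fst) =
      ((1 / (4 * π) : ℝ) : ℂ) * (2 * π / (I * ‖k‖) * ∫ p : ℝ × E2, g p *
        Complex.exp (Complex.I * ((‖k‖ * p.1 + ⟪k.snd, p.2⟫ : ℝ) : ℂ))) := by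
    simp only [Rstar_eq, mul_left_comm _ ((1 / (4 * π) : ℝ) : ℂ), integral_const_mul]
    congr 1
    simp only [← integral_const_mul]
    rw [integral_integral_swap hF2]
    simp only [hinner, integral_const_mul]
    congr 1
    rw [Measure.volume_eq_prod, integral_prod_symm _ hgi]
  rw [hL]
  unfold FT at hg
  rw [mul_left_comm] at hg
  have hg2 := mul_left_cancel₀ hc0 hg
  rw [hg2]
  push_cast
  field_simp
  try norm_num

end main

theorem stmt5 (φ g : SchwartzMap (ℝ × EuclideanSpace ℝ (Fin 2)) ℂ)
    (hφeven : ∀ (t : ℝ) (ξ : EuclideanSpace ℝ (Fin 2)), φ (-t, ξ) = φ (t, ξ))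
    (hgodd : ∀ (t : ℝ) (ξ : EuclideanSpace ℝ (Fin 2)), g (-t, ξ) = -g (t, ξ))
    (hFT : ∀ (ω : ℝ) (σ : EuclideanSpace ℝ (Fin 2)), ‖σ‖ ≤ |ω| →
      FT (⇑g) ω σ = 2 * Complex.I * (ω : ℂ) * FT (⇑φ) (Real.sqrt (ω ^ 2 - ‖σ‖ ^ 2)) σ) :
    ∀ (x₁₂ : EuclideanSpace ℝ (Fin 2)) (x₃ : ℝ),
      Rstar (⇑g) (x₁₂, x₃) = φ (x₃, x₁₂) := by
  intro x₁₂ x₃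
  obtain ⟨C, hC, hb⟩ := g_bound g hgodd
  let Φ : SchwartzMap W3 ℂ := SchwartzMap.compCLMOfContinuousLinearEquiv ℂ
    (WithLp.prodContinuousLinearEquiv 2 ℝ ℝ E2) φ
  have hΦ : ∀ w, Φ w = φ (w.fst, w.snd) := fun w => rfl
  let U : W3 → ℂ := fun w => Rstar g (w.snd, w.fst)
  have hUc : Continuous U := Rstar_cont g C hC hb
  have hUi : Integrable U := Rstar_int g C hC hb
  have hne : ∀ᵐ k : W3, k ≠ 0 := by
    rw [ae_iff]; simp
  have hk : ∀ᵐ k : W3, FourierTransform.fourier U k = FourierTransform.fourier (⇑Φ) k := by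
    filter_upwards [hne] with k hk
    have h := main_fourier g C φ hC hb hφeven hgodd hFT ((-2 * π) • k)
      (smul_ne_zero (by simp [Real.pi_ne_zero]) hk)
    rw [Real.fourier_eq', Real.fourier_eq']
    simp only [real_inner_smul_left] at h
    simp only [smul_eq_mul, mul_comm _ I, real_inner_comm k]
    exact h
  have hΦi : Integrable (FourierTransform.fourier (⇑Φ)) := by
    rw [← SchwartzMap.fourier_coe]; exact SchwartzMap.integrable _
  have h1 := hUc.fourierInv_fourier_eq hUi (hΦi.congr (hk.mono fun _ h => h.symm))
  have h2 := Φ.continuous.fourierInv_fourier_eq Φ.integrable hΦi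
  have h3 : FourierTransformInv.fourierInv (FourierTransform.fourier U) =
      FourierTransformInv.fourierInv (FourierTransform.fourier (⇑Φ)) := by
    ext w
    rw [Real.fourierInv_eq', Real.fourierInv_eq']
    exact integral_congr_ae (hk.mono fun v hv => by simp only [hv])
  rw [h1, h2] at h3
  exact congrFun h3 (WithLp.toLp 2 (x₃, x₁₂))
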